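/- arXiv:1801.06990 — 5 statements merged into one kernel-verified Lean document; each statement's English description precedes it below -/
import Mathlib

section
/- Let a, b be integers with b ≥ 1 and gcd(a,b) = 1, and let n ≥ 1. Then n! divides the integer a(a−b)(a−2b)⋯(a−(n−1)b)·b^{n−1}. -/
/-- An integer divisor of `n!` that is coprime to the common difference divides every product of
`n` consecutive terms of an arithmetic progression. -/
theorem dvd_prod_sub_mul_of_dvd_factorial {a b m : ℤ} {n : ℕ} (hm : m ∣ (n.factorial : ℤ))
    (hmb : IsCoprime m b) : m ∣ ∏ i ∈ Finset.range n, (a - (i : ℤ) * b) := by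
  obtain ⟨u, v, huv⟩ := hmb
  have hcongr : ∏ i ∈ Finset.range n, (a - (i : ℤ) * b) ≡
      ∏ i ∈ Finset.range n, -b * (-(a * v) + (i : ℤ)) [ZMOD m] := by
    refine Int.ModEq.prod fun i _ => (Int.modEq_iff_dvd.2 ⟨-(a * u), ?_⟩)
    linear_combination a * huv
  rw [hcongr.dvd_iff, Finset.prod_mul_distrib]
  exact (hm.trans (Nat.factorial_coe_dvd_prod n _)).mul_left _

/-- `n!` divides `a(a-b)(a-2b)⋯(a-(n-1)b)·b^{n-1}` for coprime integers `a, b` with `b ≥ 1`. -/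
theorem factorial_dvd_prod_mul_pow (a b : ℤ) (hb : 1 ≤ b) (hab : Int.gcd a b = 1)
    (n : ℕ) (hn : 1 ≤ n) :
    (n.factorial : ℤ) ∣ (∏ i ∈ Finset.range n, (a - (i : ℤ) * b)) * b ^ (n - 1) := by
  rw [Int.natCast_dvd, Nat.dvd_iff_prime_pow_dvd_dvd]
  intro p k hp hk
  rw [← Int.natCast_dvd, Nat.cast_pow]
  by_cases hpb : (p : ℤ) ∣ b
  · have : Fact p.Prime := ⟨hp⟩
    have hk' : k ≤ n - 1 := by
      have hle := (padicValNat_dvd_iff_le n.factorial_ne_zero).1 hk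
      have hlt := padicValNat_factorial_lt_of_ne_zero p (n := n) (by omega)
      omega
    exact ((pow_dvd_pow _ hk').trans (pow_dvd_pow_of_dvd hpb _)).mul_left _
  · refine (dvd_prod_sub_mul_of_dvd_factorial (by exact_mod_cast hk) ?_).mul_right _
    exact ((Nat.prime_iff_prime_int.1 hp).coprime_iff_not_dvd.2 hpb).pow_left
end

section
/- Let a, b be integers with b ≥ 1 and gcd(a,b) = 1, let n ≥ 1, and let c_{a/b}(n) = (1/n!)·(a/b)(a/b − 1)(a/b − 2)⋯(a/b − n + 1) be the generalized binomial coefficient. Then for every prime p dividing b, the p-adic valuation of the denominator (in lowest terms) of c_{a/b}(n) equals n·ord_p(b) + ord_p(n!). -/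
/-- Generalized binomial coefficient `C(k, n) = k(k-1)⋯(k-n+1)/n!` for rational `k`. -/
noncomputable def qbinom (k : ℚ) (n : ℕ) : ℚ :=
  (∏ i ∈ Finset.range n, (k - i)) / (n.factorial : ℚ)

/-- If `p` does not divide `u`, cancelling common factors in `u / v` does not change the
`p`-adic valuation of the denominator. -/
theorem padicValNat_den_div_of_not_dvd {p : ℕ} [hp : Fact p.Prime] {u v : ℤ}
    (hu : ¬ (p : ℤ) ∣ u) (hv : v ≠ 0) :
    padicValNat p ((u : ℚ) / v).den = padicValInt p v := by
  have hu0 : u ≠ 0 := by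
    rintro rfl
    exact hu (dvd_zero _)
  have hval : padicValRat p ((u : ℚ) / v) = -(padicValInt p v : ℤ) := by
    rw [padicValRat.div (by exact_mod_cast hu0) (by exact_mod_cast hv), padicValRat.of_int,
      padicValRat.of_int, padicValInt.eq_zero_of_not_dvd hu]
    simp
  rw [padicValRat] at hval
  by_cases hd : p ∣ ((u : ℚ) / v).den
  · have hnum : ¬ (p : ℤ) ∣ ((u : ℚ) / v).num := fun h ↦
      Nat.not_coprime_of_dvd_of_dvd hp.out.one_lt (Int.natCast_dvd.mp h) hd
        ((u : ℚ) / v).reduced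
    rw [padicValInt.eq_zero_of_not_dvd hnum] at hval
    omega
  · rw [padicValNat.eq_zero_of_not_dvd hd] at hval ⊢
    omega

theorem qbinom_div_eq (a b : ℤ) (hb : b ≠ 0) (n : ℕ) :
    qbinom ((a : ℚ) / b) n =
      ((∏ i ∈ Finset.range n, (a - i * b) : ℤ) : ℚ) / ((b ^ n * n.factorial : ℤ) : ℚ) := by
  have hb' : (b : ℚ) ≠ 0 := by exact_mod_cast hb
  have h : ∀ i ∈ Finset.range n, (a : ℚ) / b - (i : ℚ) = (a - i * b) / b := fun i _ ↦ by
    field_simp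
  rw [qbinom, Finset.prod_congr rfl h, Finset.prod_div_distrib]
  simp [div_div]

/-- For every prime `p ∣ b`, the `p`-adic valuation of the denominator of the generalized
binomial coefficient `c_{a/b}(n) = C(a/b, n)` equals `n·ord_p(b) + ord_p(n!)`. -/
theorem padicVal_den_qbinom (a b : ℤ) (hb : 1 ≤ b) (hab : Int.gcd a b = 1)
    (n : ℕ) (hn : 1 ≤ n) (p : ℕ) (hp : p.Prime) (hpb : (p : ℤ) ∣ b) :
    padicValNat p (qbinom ((a : ℚ) / (b : ℚ)) n).den =
      n * padicValInt p b + padicValNat p n.factorial := by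
  have : Fact p.Prime := ⟨hp⟩
  have hb0 : b ≠ 0 := by omega
  have hf : (n.factorial : ℤ) ≠ 0 := by exact_mod_cast n.factorial_ne_zero
  have hpa : ¬ (p : ℤ) ∣ a := fun h ↦
    (Nat.prime_iff_prime_int.mp hp).not_isUnit
      ((Int.isCoprime_iff_gcd_eq_one.mpr hab).isUnit_of_dvd' h hpb)
  have hu : ¬ (p : ℤ) ∣ ∏ i ∈ Finset.range n, (a - i * b) := by
    rw [(Nat.prime_iff_prime_int.mp hp).dvd_finsetProd_iff]
    rintro ⟨i, -, hi⟩
    exact hpa ((dvd_sub_left (hpb.mul_left _)).mp hi)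
  rw [qbinom_div_eq a b hb0, padicValNat_den_div_of_not_dvd hu (mul_ne_zero (pow_ne_zero n hb0) hf),
    padicValInt.mul (pow_ne_zero n hb0) hf, padicValInt.of_nat, padicValInt, Int.natAbs_pow,
    padicValNat.pow, padicValInt]
end

section
/- Let n be a positive integer whose residue modulo 7 lies in {3, 5, 6}. Then σ_3(n) ≡ 0 (mod 7), where σ_3(n) = Σ_{d | n} d³ is the sum of the cubes of the positive divisors of n. -/
/-- Complementary factors of a quadratic non-residue modulo `7` have opposite cubes. -/
theorem ZMod.seven_cube_eq_neg_cube_of_mul (a b : ZMod 7)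
    (h : a * b = 3 ∨ a * b = 5 ∨ a * b = 6) : b ^ 3 = -a ^ 3 := by
  revert a b
  decide

/-- If `n ≡ 3, 5` or `6 (mod 7)`, then `σ_3(n) = Σ_{d ∣ n} d³ ≡ 0 (mod 7)`. -/
theorem sigma_three_mod_seven (n : ℕ) (hn : 0 < n)
    (h : n % 7 = 3 ∨ n % 7 = 5 ∨ n % 7 = 6) :
    7 ∣ ∑ d ∈ n.divisors, d ^ 3 := by
  have hn7 : (n : ZMod 7) = 3 ∨ (n : ZMod 7) = 5 ∨ (n : ZMod 7) = 6 := by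
    rw [← ZMod.natCast_mod n 7]
    rcases h with h | h | h <;> simp [h]
  rw [← ZMod.natCast_eq_zero_iff]
  push_cast
  have hneg : ∑ d ∈ n.divisors, (d : ZMod 7) ^ 3 = -∑ d ∈ n.divisors, (d : ZMod 7) ^ 3 := by
    conv_lhs => rw [← Nat.sum_div_divisors n fun d ↦ (d : ZMod 7) ^ 3]
    rw [← Finset.sum_neg_distrib]
    refine Finset.sum_congr rfl fun d hd ↦ ZMod.seven_cube_eq_neg_cube_of_mul _ _ ?_
    rwa [← Nat.cast_mul, Nat.mul_div_cancel' (Nat.dvd_of_mem_divisors hd)]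
  have eq_zero_of_eq_neg : ∀ x : ZMod 7, x = -x → x = 0 := by decide
  exact eq_zero_of_eq_neg _ hneg
end

section
/- For every integer n ≥ 0, the number of partitions p(5n + 4) is divisible by 5. -/
open Finset

/-- The Gaussian binomial coefficient `[n choose k]` evaluated at `q`. -/
def gaussBinom {S : Type*} [CommRing S] (q : S) : ℕ → ℕ → S
  | _, 0 => 1
  | 0, _ + 1 => 0
  | n + 1, k + 1 => q ^ (k + 1) * gaussBinom q n (k + 1) + gaussBinom q n k

section GaussBinom

variable {S : Type*} [CommRing S] (q : S)

theorem gaussBinom_zero_right (n : ℕ) : gaussBinom q n 0 = 1 := by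
  cases n <;> rfl

theorem gaussBinom_succ_succ (n k : ℕ) : gaussBinom q (n + 1) (k + 1) =
    q ^ (k + 1) * gaussBinom q n (k + 1) + gaussBinom q n k := rfl

theorem gaussBinom_eq_zero_of_lt {n k : ℕ} (h : n < k) : gaussBinom q n k = 0 := by
  induction n generalizing k with
  | zero =>
    obtain ⟨k, rfl⟩ := Nat.exists_eq_add_of_lt h
    rfl
  | succ n ih =>
    obtain ⟨k, rfl⟩ := Nat.exists_eq_add_of_lt h
    rw [gaussBinom_succ_succ, ih (by omega), ih (by omega)]
    simp

theorem gaussBinom_self (n : ℕ) : gaussBinom q n n = 1 := by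
  induction n with
  | zero => rfl
  | succ n ih => rw [gaussBinom_succ_succ, gaussBinom_eq_zero_of_lt q (by omega), ih]; simp

/-- The `q`-Pochhammer symbol `(1 - q) (1 - q ^ 2) ⋯ (1 - q ^ n)`. -/
def qFactorial (n : ℕ) : S := ∏ i ∈ range n, (1 - q ^ (i + 1))

theorem qFactorial_succ (n : ℕ) : qFactorial q (n + 1) = qFactorial q n * (1 - q ^ (n + 1)) :=
  prod_range_succ _ _

theorem gaussBinom_add_mul_qFactorial (k m : ℕ) :
    gaussBinom q (k + m) k * (qFactorial q k * qFactorial q m) = qFactorial q (k + m) := by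
  induction k generalizing m with
  | zero => simp [gaussBinom_zero_right, qFactorial]
  | succ k ihk =>
    induction m with
    | zero => simp [gaussBinom_self, qFactorial]
    | succ m ihm =>
      have h1 := ihk (m + 1)
      rw [show k + 1 + (m + 1) = k + (m + 1) + 1 by ring, gaussBinom_succ_succ,
        qFactorial_succ q (k + (m + 1))]
      rw [show k + 1 + m = k + (m + 1) by ring] at ihm
      rw [qFactorial_succ q k] at ihm ⊢
      rw [qFactorial_succ q m] at h1 ⊢
      linear_combination (q ^ (k + 1) * (1 - q ^ (m + 1))) * ihm + (1 - q ^ (k + 1)) * h1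

/-- The `q`-binomial theorem. -/
theorem prod_add_mul_pow_eq_sum_gaussBinom (n : ℕ) (y z : S) :
    ∏ i ∈ range n, (y + z * q ^ i) =
      ∑ k ∈ range (n + 1), q ^ k.choose 2 * gaussBinom q n k * z ^ k * y ^ (n - k) := by
  induction n generalizing z with
  | zero => simp [gaussBinom_zero_right]
  | succ n ih =>
    have hprod : ∏ i ∈ range (n + 1), (y + z * q ^ i) =
        (y + z) * ∏ i ∈ range n, (y + z * q * q ^ i) := by
      rw [prod_range_succ', mul_comm]
      simp [pow_succ', mul_assoc]
    set t : ℕ → S := fun k ↦ q ^ k.choose 2 * gaussBinom q n k * (z * q) ^ k with ht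
    have hshift : y * ∑ k ∈ range (n + 1), t k * y ^ (n - k) =
        y ^ (n + 1) + ∑ k ∈ range (n + 1), t (k + 1) * y ^ (n - k) := by
      have hlast : ∑ k ∈ range (n + 2), t k * y ^ (n + 1 - k) =
          y * ∑ k ∈ range (n + 1), t k * y ^ (n - k) := by
        rw [sum_range_succ, mul_sum]
        have h0 : t (n + 1) = 0 := by simp [ht, gaussBinom_eq_zero_of_lt q (Nat.lt_succ_self n)]
        rw [h0, zero_mul, add_zero]
        refine sum_congr rfl fun k hk ↦ ?_
        rw [Nat.succ_sub (by grind), pow_succ]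
        ring
      rw [← hlast, sum_range_succ', add_comm]
      simp [ht, gaussBinom_zero_right]
    rw [hprod, ih, add_mul, hshift, sum_range_succ' _ (n + 1), add_assoc, mul_sum,
      ← sum_add_distrib, add_comm]
    congr 1
    · refine sum_congr rfl fun k _ ↦ ?_
      rw [gaussBinom_succ_succ, Nat.add_sub_add_right]
      have hc : (k + 1).choose 2 = k + k.choose 2 := by
        rw [Nat.choose_succ_succ', Nat.choose_one_right]
      simp only [ht, hc]
      ring
    · simp [gaussBinom_zero_right]

end GaussBinom

section CentralDerivative

open Polynomial

variable {S : Type*} [CommRing S] (q : S)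

theorem gaussBinom_C (n k : ℕ) : gaussBinom (C q) n k = C (gaussBinom q n k) := by
  induction n generalizing k with
  | zero => cases k <;> simp [gaussBinom]
  | succ n ih => cases k <;> simp [gaussBinom, ih]

/-- The derivative of the `q`-binomial theorem for `2 * n + 1` factors at the root of the
central factor. -/
theorem prod_mul_prod_eq_sum_gaussBinom (n : ℕ) :
    q ^ n * (∏ i ∈ range n, (q ^ n - q ^ i)) * ∏ i ∈ range n, (q ^ n - q ^ (n + 1 + i)) =
      ∑ k ∈ range (2 * n + 2), (-1) ^ (k + 1) * (k : S) *
        (q ^ (k.choose 2 + n * (2 * n + 1 - k)) * gaussBinom q (2 * n + 1) k) := by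
  have h := congrArg (fun p ↦ -(derivative p).eval 1)
    (prod_add_mul_pow_eq_sum_gaussBinom (C q) (2 * n + 1) (C (q ^ n)) (-X))
  rw [show 2 * n + 1 = n + 1 + n by ring, prod_range_add, prod_range_succ,
    show (C (q ^ n) + -X * C q ^ n : S[X]) = C (q ^ n) * (1 - X) by rw [C_pow]; ring] at h
  simp only [derivative_mul, derivative_sub, derivative_one, derivative_X, derivative_C,
    eval_add, eval_mul, eval_sub, eval_one, eval_X, eval_C, eval_prod, eval_neg, eval_pow,
    eval_zero, derivative_sum, eval_finsetSum, gaussBinom_C, ← C_pow] at h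
  rw [show 2 * n + 1 = n + 1 + n by ring, show 2 * n + 2 = n + 1 + n + 1 by ring]
  rw [← sum_neg_distrib] at h
  convert h using 1
  · simp only [neg_one_mul, ← sub_eq_add_neg]
    ring
  · refine sum_congr rfl fun k _ ↦ ?_
    rw [show ((-X) ^ k : S[X]) = C ((-1) ^ k) * X ^ k by simp [neg_pow (X : S[X])]]
    simp only [derivative_mul, derivative_X_pow, derivative_C, eval_add, eval_mul, eval_C,
      eval_pow, eval_X, eval_zero, one_pow]
    ring

theorem prod_pow_sub_pow (n : ℕ) :
    ∏ i ∈ range n, (q ^ n - q ^ i) = (-1) ^ n * q ^ n.choose 2 * qFactorial q n := by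
  induction n with
  | zero => simp [qFactorial]
  | succ n ih =>
    have hfac : ∀ i ∈ range n, q ^ (n + 1) - q ^ (i + 1) = q * (q ^ n - q ^ i) :=
      fun i _ ↦ by ring
    rw [prod_range_succ', prod_congr rfl hfac, prod_mul_distrib, ih, qFactorial_succ,
      Nat.choose_succ_succ' n 1, Nat.choose_one_right]
    simp only [prod_const, card_range]
    ring

theorem prod_pow_sub_pow_add (n : ℕ) :
    ∏ i ∈ range n, (q ^ n - q ^ (n + 1 + i)) = q ^ (n * n) * qFactorial q n := by
  have hfac : ∀ i ∈ range n, q ^ n - q ^ (n + 1 + i) = q ^ n * (1 - q ^ (i + 1)) :=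
    fun i _ ↦ by ring
  rw [prod_congr rfl hfac, prod_mul_distrib, qFactorial]
  simp [pow_mul]

end CentralDerivative

namespace PowerSeries

section Jacobi

variable {R : Type*} [CommRing R]

theorem isUnit_qFactorial_X (n : ℕ) : IsUnit (qFactorial (X : R⟦X⟧) n) := by
  rw [isUnit_iff_constantCoeff]
  simp [qFactorial, map_prod]

theorem gaussBinom_X_symm (k m : ℕ) :
    gaussBinom (X : R⟦X⟧) (k + m) m = gaussBinom X (k + m) k := by
  refine ((isUnit_qFactorial_X k).mul (isUnit_qFactorial_X m)).mul_right_cancel ?_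
  rw [gaussBinom_add_mul_qFactorial, mul_comm (qFactorial X k), add_comm,
    gaussBinom_add_mul_qFactorial]

/-- A finite form of Jacobi's identity. -/
theorem qFactorial_X_sq (n : ℕ) : qFactorial (X : R⟦X⟧) n ^ 2 =
    ∑ j ∈ range (n + 1), (-1) ^ j * (2 * j + 1 : R⟦X⟧) *
      (X ^ (j + 1).choose 2 * gaussBinom X (2 * n + 1) (n - j)) := by
  refine X_pow_mul_cancel (k := n + n.choose 2 + n * n) ?_
  have h := prod_mul_prod_eq_sum_gaussBinom (X : R⟦X⟧) n
  rw [prod_pow_sub_pow, prod_pow_sub_pow_add, show 2 * n + 2 = n + 1 + (n + 1) by ring,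
    sum_range_add, ← sum_range_reflect, ← sum_add_distrib] at h
  have hsign : ((-1) ^ n * (-1) ^ n : R⟦X⟧) = 1 := by rw [← mul_pow]; simp
  calc
    _ = (-1 : R⟦X⟧) ^ n * (X ^ n * ((-1) ^ n * X ^ n.choose 2 * qFactorial X n) *
        (X ^ (n * n) * qFactorial X n)) := by
      linear_combination (-X ^ (n + n.choose 2 + n * n) * qFactorial X n ^ 2) * hsign
    _ = _ := by
      rw [h, mul_sum, mul_sum]
      refine sum_congr rfl fun j hj ↦ ?_
      obtain ⟨m, rfl⟩ := Nat.exists_eq_add_of_le (Nat.lt_succ_iff.mp (mem_range.mp hj))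
      have hsymm : gaussBinom (X : R⟦X⟧) (2 * (j + m) + 1) (j + m + 1 + j) =
          gaussBinom X (2 * (j + m) + 1) m := by
        have := gaussBinom_X_symm (R := R) m (j + m + 1 + j)
        rwa [show m + (j + m + 1 + j) = 2 * (j + m) + 1 by ring] at this
      have hexp₁ : m.choose 2 + (j + m) * (2 * (j + m) + 1 - m) =
          (j + m) + (j + m).choose 2 + (j + m) * (j + m) + (j + 1).choose 2 := by
        rw [show 2 * (j + m) + 1 - m = 2 * j + m + 1 by omega, ← Nat.cast_inj (R := ℚ)]
        push_cast [Nat.cast_choose_two]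
        ring
      have hexp₂ : (j + m + 1 + j).choose 2 + (j + m) * (2 * (j + m) + 1 - (j + m + 1 + j)) =
          (j + m) + (j + m).choose 2 + (j + m) * (j + m) + (j + 1).choose 2 := by
        rw [show 2 * (j + m) + 1 - (j + m + 1 + j) = m by omega, ← Nat.cast_inj (R := ℚ)]
        push_cast [Nat.cast_choose_two]
        ring
      rw [show j + m + 1 - 1 - j = m by omega, show j + m - j = m by omega, hsymm, hexp₁, hexp₂]
      have hm : ((-1) ^ m * (-1) ^ m : R⟦X⟧) = 1 := by rw [← mul_pow]; simp
      have hj' : ((-1) ^ j * (-1) ^ j : R⟦X⟧) = 1 := by rw [← mul_pow]; simp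
      push_cast
      simp only [pow_add _ _ ((j + 1).choose 2)]
      generalize (X : R⟦X⟧) ^ (j + m + (j + m).choose 2 + (j + m) * (j + m)) = A
      linear_combination ((-1) ^ j * A * X ^ (j + 1).choose 2 *
        gaussBinom X (2 * (j + m) + 1) m) * ((-m + (2 * j + m + 1) * ((-1) ^ j * (-1) ^ j)) * hm +
          (2 * j + m + 1) * hj')

theorem X_pow_dvd_qFactorial_add_sub (n k : ℕ) :
    (X : R⟦X⟧) ^ (n + 1) ∣ qFactorial X (n + k) - qFactorial X n := by
  induction k with
  | zero => simp
  | succ k ih =>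
    rw [← add_assoc, qFactorial_succ, mul_one_sub, sub_right_comm]
    exact dvd_sub ih ((pow_dvd_pow _ (by omega)).mul_left _)

theorem X_pow_dvd_qFactorial_mul_gaussBinom_sub_one (m j : ℕ) :
    (X : R⟦X⟧) ^ (m + 1) ∣
      qFactorial X (m + j) * gaussBinom X (2 * (m + j) + 1) m - 1 := by
  have h := gaussBinom_add_mul_qFactorial (X : R⟦X⟧) m (m + (2 * j + 1))
  have h₁ := X_pow_dvd_qFactorial_add_sub (R := R) m j
  have h₂ := X_pow_dvd_qFactorial_add_sub (R := R) (m + (2 * j + 1)) m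
  rw [add_comm (m + (2 * j + 1)) m] at h₂
  rw [show 2 * (m + j) + 1 = m + (m + (2 * j + 1)) by ring]
  refine (((isUnit_qFactorial_X (R := R) m).mul
    (isUnit_qFactorial_X (m + (2 * j + 1)))).dvd_mul_right).mp ?_
  have h₂' := (pow_dvd_pow (X : R⟦X⟧) (show m + 1 ≤ m + (2 * j + 1) + 1 by omega)).trans h₂
  convert dvd_add (h₁.mul_right (qFactorial X (m + (m + (2 * j + 1)))))
    (h₂'.mul_left (qFactorial X m)) using 1
  linear_combination (qFactorial X (m + j)) * h

/-- Jacobi's identity for the cube of the Euler product, truncated at `X ^ (n + 1)`. -/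
theorem X_pow_dvd_qFactorial_pow_three_sub (n : ℕ) :
    (X : R⟦X⟧) ^ (n + 1) ∣ qFactorial X n ^ 3 -
      ∑ j ∈ range (n + 1), (-1) ^ j * (2 * j + 1 : R⟦X⟧) * X ^ (j + 1).choose 2 := by
  rw [pow_succ' (qFactorial X n), qFactorial_X_sq, mul_sum, ← sum_sub_distrib]
  refine dvd_sum fun j hj ↦ ?_
  obtain ⟨m, rfl⟩ := Nat.exists_eq_add_of_le' (Nat.lt_succ_iff.mp (mem_range.mp hj))
  rw [Nat.add_sub_cancel]
  obtain ⟨c, hc⟩ := X_pow_dvd_qFactorial_mul_gaussBinom_sub_one (R := R) m j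
  have hj : m + j + 1 ≤ (j + 1).choose 2 + (m + 1) := by
    rw [Nat.choose_succ_succ', Nat.choose_one_right]
    omega
  refine (pow_dvd_pow _ hj).trans ⟨(-1) ^ j * (2 * j + 1) * c, ?_⟩
  rw [pow_add]
  linear_combination ((-1) ^ j * (2 * j + 1) * X ^ (j + 1).choose 2) * hc

theorem X_pow_dvd_pentagonalSeries_sub_qFactorial (n : ℕ) :
    (X : R⟦X⟧) ^ (n + 1) ∣ pentagonalSeries R - qFactorial X n := by
  rw [X_pow_dvd_iff]
  intro m hm
  obtain ⟨N, hN, hnN⟩ := ((Filter.tendsto_finset_range.eventually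
    (coeff_prod_one_sub_X_pow_eventually_eq R m)).and (Filter.eventually_ge_atTop n)).exists
  obtain ⟨k, rfl⟩ := Nat.exists_eq_add_of_le hnN
  rw [map_sub, ← hN, ← map_sub]
  exact X_pow_dvd_iff.mp (X_pow_dvd_qFactorial_add_sub n k) m hm

/-- **Jacobi's identity** for the cube of the Euler product, in terms of coefficients. -/
theorem coeff_pentagonalSeries_pow_three (n : ℕ) :
    coeff n (pentagonalSeries R ^ 3) =
      ∑ j ∈ range (n + 1), if n = (j + 1).choose 2 then (-1) ^ j * (2 * j + 1 : R) else 0 := by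
  have h := dvd_add ((X_pow_dvd_pentagonalSeries_sub_qFactorial (R := R) n).trans
    (sub_dvd_pow_sub_pow _ _ 3)) (X_pow_dvd_qFactorial_pow_three_sub n)
  rw [sub_add_sub_cancel, X_pow_dvd_iff] at h
  have hn := h n n.lt_succ_self
  rw [map_sub, sub_eq_zero, map_sum] at hn
  rw [hn]
  refine sum_congr rfl fun j _ ↦ ?_
  rw [show ((-1) ^ j * (2 * (j : R⟦X⟧) + 1) * X ^ (j + 1).choose 2 : R⟦X⟧) =
    C ((-1) ^ j * (2 * j + 1 : R)) * X ^ (j + 1).choose 2 by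
      simp [show (C 2 : R⟦X⟧) = 2 from map_ofNat C 2], coeff_C_mul, coeff_X_pow]
  simp

end Jacobi

theorem coeff_pentagonalSeries_pow_three_zmod_five (n : ℕ) (hn : 1 < n % 5) :
    coeff n (pentagonalSeries (ZMod 5) ^ 3) = 0 := by
  rw [coeff_pentagonalSeries_pow_three]
  refine sum_eq_zero fun j _ ↦ ?_
  split_ifs with h
  · have hj : j % 5 = 2 := by
      have h2 : n * 2 = (j + 1) * j := by
        rw [h, Nat.choose_two_right, Nat.add_sub_cancel,
          Nat.div_mul_cancel (by simpa [mul_comm] using (Nat.even_mul_succ_self j).two_dvd)]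
      have h5 : n * 2 % 5 = (j + 1) * j % 5 := by rw [h2]
      rw [Nat.mul_mod n, Nat.mul_mod (j + 1), Nat.add_mod j 1] at h5
      have : j % 5 < 5 := Nat.mod_lt _ (by norm_num)
      have : n % 5 < 5 := Nat.mod_lt _ (by norm_num)
      generalize j % 5 = a at *
      generalize n % 5 = b at *
      interval_cases a <;> interval_cases b <;> simp_all
    have : ((2 * j + 1 : ℕ) : ZMod 5) = 0 := by
      rw [ZMod.natCast_eq_zero_iff]
      omega
    push_cast at this
    rw [this, mul_zero]
  · rfl

/-- If the exponents of `f` and `g` have residues at most `a` and `b` modulo `d`, then those of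
`f * g` have residues at most `a + b`. -/
theorem coeff_mul_eq_zero_of_lt_mod {R : Type*} [Semiring R] {f g : R⟦X⟧} {d a b : ℕ}
    (hf : ∀ n, a < n % d → coeff n f = 0) (hg : ∀ n, b < n % d → coeff n g = 0)
    (n : ℕ) (hn : a + b < n % d) : coeff n (f * g) = 0 := by
  rw [coeff_mul]
  refine sum_eq_zero fun ⟨i, j⟩ hij ↦ ?_
  rw [HasAntidiagonal.mem_antidiagonal] at hij
  by_cases hi : a < i % d
  · simp [hf i hi]
  by_cases hj : b < j % d
  · simp [hg j hj]
  have h := Nat.mod_le (i % d + j % d) d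
  rw [← Nat.add_mod, hij] at h
  omega

theorem coeff_pow_eq_zero_of_not_dvd {p : ℕ} [Fact p.Prime] (f : (ZMod p)⟦X⟧) {n : ℕ}
    (hn : ¬ p ∣ n) : coeff n (f ^ p) = 0 := by
  rw [← coeff_coe_trunc_of_lt n.lt_succ_self, ← trunc_trunc_pow,
    coeff_coe_trunc_of_lt n.lt_succ_self, ← Polynomial.coe_pow, ← ZMod.expand_card,
    Polynomial.coeff_coe, Polynomial.coeff_expand (Fact.out : p.Prime).pos, if_neg hn]

/-- The generating function of the partition numbers is the inverse of the Euler product. -/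
theorem mk_card_partition_mul_pentagonalSeries (R : Type*) [CommRing R] :
    (mk fun n ↦ (Fintype.card n.Partition : R)) * pentagonalSeries R = 1 := by
  nontriviality R
  let _ : TopologicalSpace R := ⊥
  have : DiscreteTopology R := ⟨rfl⟩
  open WithPiTopology in
  have h := (Nat.Partition.hasProd_powerSeriesMk_card_restricted R fun _ ↦ True).mul
    (hasProd_one_sub_X_pow R)
  simp_rw [if_true, pow_mul] at h
  open WithPiTopology in
  have hone : ∀ i : ℕ, (∑' j : ℕ, ((X : R⟦X⟧) ^ (i + 1)) ^ j) * (1 - X ^ (i + 1)) = 1 :=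
    fun i ↦ tsum_pow_mul_one_sub_of_constantCoeff_eq_zero (by simp)
  simp_rw [hone] at h
  simpa [Nat.Partition.restricted] using h.unique hasProd_one

end PowerSeries

open PowerSeries in
/-- Ramanujan's congruence: `p(5n + 4) ≡ 0 (mod 5)`. -/
theorem partition_five_n_add_four (n : ℕ) :
    5 ∣ Fintype.card (Nat.Partition (5 * n + 4)) := by
  have : Fact (Nat.Prime 5) := ⟨Nat.prime_five⟩
  set P : (ZMod 5)⟦X⟧ := mk fun n ↦ (Fintype.card n.Partition : ZMod 5) with hP
  set φ := pentagonalSeries (ZMod 5)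
  have hPφ : P * φ = 1 := mk_card_partition_mul_pentagonalSeries _
  have hdecomp : P = (P ^ 2) ^ 5 * (φ ^ 3 * φ ^ 3 * φ ^ 3) := by
    calc P = P * (P * φ) ^ 9 := by rw [hPφ, one_pow, mul_one]
      _ = _ := by ring
  have hpow (m : ℕ) (hm : 0 < m % 5) : coeff m ((P ^ 2) ^ 5) = 0 :=
    coeff_pow_eq_zero_of_not_dvd _ (by omega)
  have hcube := coeff_pentagonalSeries_pow_three_zmod_five
  have hzero : coeff (5 * n + 4) P = 0 := by
    rw [hdecomp]
    exact coeff_mul_eq_zero_of_lt_mod hpow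
      (coeff_mul_eq_zero_of_lt_mod (coeff_mul_eq_zero_of_lt_mod hcube hcube) hcube) _ (by omega)
  rwa [hP, coeff_mk, ZMod.natCast_eq_zero_iff] at hzero
end

section
/- For every integer n ≥ 0, the number of partitions p(7n + 5) is divisible by 7. -/
open Finset PowerSeries

section FiniteJacobi

variable (K : Type*) [Field K]

/-- The finite Euler product `∏_{i = 1}^{m} (1 - X ^ i)`. -/
noncomputable def eulerProd (m : ℕ) : K⟦X⟧ := ∏ i ∈ range m, (1 - X ^ (i + 1))

/-- The triangular number `0 + 1 + ⋯ + j`. -/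
def triangular (j : ℕ) : ℕ := ∑ i ∈ range (j + 1), i

/-- The term `(-1) ^ j * X ^ (j (j + 1) / 2)` times the Gaussian binomial coefficient
`[2 n + 1, n - j]` of the finite form of the Jacobi identity. -/
noncomputable def jacobiTerm (n j : ℕ) : K⟦X⟧ :=
  if j ≤ n then
    (-1) ^ j * X ^ triangular j * eulerProd K (2 * n + 1) *
      (eulerProd K (n + 1 + j))⁻¹ * (eulerProd K (n - j))⁻¹
  else 0

lemma triangular_succ (j : ℕ) : triangular (j + 1) = triangular j + (j + 1) :=
  sum_range_succ _ _

lemma two_mul_triangular (j : ℕ) : 2 * triangular j = j * (j + 1) := by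
  rw [triangular, mul_comm, sum_range_id_mul_two, Nat.add_sub_cancel, mul_comm]

lemma le_triangular (j : ℕ) : j ≤ triangular j := by
  cases j with
  | zero => exact Nat.zero_le _
  | succ j => rw [triangular_succ]; exact Nat.le_add_left _ _

lemma eulerProd_succ (m : ℕ) : eulerProd K (m + 1) = eulerProd K m * (1 - X ^ (m + 1)) :=
  prod_range_succ _ _

lemma constantCoeff_eulerProd (m : ℕ) : constantCoeff (eulerProd K m) = 1 := by
  simp [eulerProd, map_prod]

lemma eulerProd_mul_inv (m : ℕ) : eulerProd K m * (eulerProd K m)⁻¹ = 1 :=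
  PowerSeries.mul_inv_cancel _ (by simp [constantCoeff_eulerProd])

lemma eulerProd_inv_eq (m : ℕ) :
    (eulerProd K m)⁻¹ = (1 - X ^ (m + 1)) * (eulerProd K (m + 1))⁻¹ := by
  have h := eulerProd_mul_inv K (m + 1)
  have h' := eulerProd_mul_inv K m
  rw [eulerProd_succ] at h ⊢
  linear_combination (-(eulerProd K m)⁻¹) * h +
    (1 - X ^ (m + 1)) * (eulerProd K m * (1 - X ^ (m + 1)))⁻¹ * h'

lemma jacobiTerm_eq_zero {n j : ℕ} (h : n < j) : jacobiTerm K n j = 0 :=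
  if_neg (by omega)

lemma jacobiTerm_succ_zero (n : ℕ) :
    jacobiTerm K (n + 1) 0 = (1 + X ^ (n + 1) + X ^ (2 * (n + 1))) * jacobiTerm K n 0 -
      X ^ (n + 1) * jacobiTerm K n 1 := by
  have e1 : eulerProd K (2 * (n + 1) + 1) =
      eulerProd K (2 * n + 1) * (1 - X ^ (2 * n + 2)) * (1 - X ^ (2 * n + 3)) := by
    rw [← eulerProd_succ, ← eulerProd_succ]; rfl
  have ht : triangular 0 = 0 := rfl
  have ht1 : triangular 1 = 1 := rfl
  rcases n with _ | n
  · simp only [jacobiTerm, e1, ht, ht1]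
    have h0 := eulerProd_inv_eq K 0
    have h1 := eulerProd_inv_eq K 1
    norm_num at h0 h1 ⊢
    rw [h0, h1]
    ring
  · simp only [jacobiTerm, e1, ht, ht1]
    have h0 := eulerProd_inv_eq K n
    have h1 := eulerProd_inv_eq K (n + 1)
    have h2 := eulerProd_inv_eq K (n + 2)
    simp only [zero_le, if_true, Nat.sub_zero, add_zero, Nat.le_add_left, Nat.add_sub_cancel]
    simp only [add_assoc, Nat.reduceAdd] at h0 h1 h2 ⊢
    rw [h0, h1, h2]
    ring

lemma jacobiTerm_succ_succ (n j : ℕ) :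
    jacobiTerm K (n + 1) (j + 1) = (1 + X ^ (2 * (n + 1))) * jacobiTerm K n (j + 1) -
      X ^ (n + 1) * (jacobiTerm K n j + jacobiTerm K n (j + 2)) := by
  have e1 : eulerProd K (2 * (n + 1) + 1) =
      eulerProd K (2 * n + 1) * (1 - X ^ (2 * n + 2)) * (1 - X ^ (2 * n + 3)) := by
    rw [← eulerProd_succ, ← eulerProd_succ]; rfl
  rcases lt_or_ge n j with h | h
  · simp [jacobiTerm_eq_zero, h, show n < j + 1 by omega, show n < j + 2 by omega]
  obtain ⟨m, rfl⟩ := Nat.exists_eq_add_of_le h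
  have u0 := eulerProd_inv_eq K (j + m + 1 + j)
  have u1 := eulerProd_inv_eq K (j + m + 1 + j + 1)
  simp only [jacobiTerm, e1, triangular_succ]
  rw [show j + m + 1 + 1 + (j + 1) = j + m + 1 + j + 1 + 1 by ring,
    show j + m + 1 + (j + 1) = j + m + 1 + j + 1 by ring,
    show j + m + 1 + (j + 2) = j + m + 1 + j + 1 + 1 by ring, u0, u1,
    show j + m + 1 - (j + 1) = m by omega, show j + m - j = m by omega,
    if_pos (show j + 1 ≤ j + m + 1 by omega), if_pos (show j ≤ j + m by omega)]
  rcases m with _ | _ | m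
  · rw [if_neg (by omega), if_neg (by omega)]
    ring
  · rw [if_pos (by omega), if_neg (by omega), show j + (0 + 1) - (j + 1) = 0 by omega,
      eulerProd_inv_eq K 0]
    ring
  · rw [if_pos (by omega), if_pos (by omega), show j + (m + 1 + 1) - (j + 1) = m + 1 by omega,
      show j + (m + 1 + 1) - (j + 2) = m by omega,
      eulerProd_inv_eq K m, eulerProd_inv_eq K (m + 1)]
    ring

lemma sum_jacobiTerm_succ (n L : ℕ) :
    ∑ j ∈ range (L + 1), (2 * j + 1 : K⟦X⟧) * jacobiTerm K (n + 1) j =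
      (1 - X ^ (n + 1)) ^ 2 * ∑ j ∈ range (L + 1), (2 * j + 1 : K⟦X⟧) * jacobiTerm K n j +
      X ^ (n + 1) * ((2 * L + 3 : K⟦X⟧) * jacobiTerm K n L -
        (2 * L + 1 : K⟦X⟧) * jacobiTerm K n (L + 1)) := by
  induction L with
  | zero =>
    simp only [zero_add, sum_range_one, jacobiTerm_succ_zero]
    push_cast
    ring
  | succ L ih =>
    rw [sum_range_succ, ih, sum_range_succ _ (L + 1), jacobiTerm_succ_succ]
    push_cast
    ring

/-- A finite form of the Jacobi identity for the cube of the Euler product. -/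
theorem eulerProd_sq (n : ℕ) :
    eulerProd K n ^ 2 = ∑ j ∈ range (n + 1), (2 * j + 1 : K⟦X⟧) * jacobiTerm K n j := by
  induction n with
  | zero =>
    have h := eulerProd_mul_inv K 1
    have h0 : eulerProd K 0 = 1 := rfl
    have ht : triangular 0 = 0 := rfl
    simp [jacobiTerm, h, h0, ht]
  | succ n ih =>
    rw [sum_jacobiTerm_succ, sum_range_succ, ← ih, eulerProd_succ,
      jacobiTerm_eq_zero K (by omega), jacobiTerm_eq_zero K (by omega)]
    ring

lemma X_pow_dvd_eulerProd_sub {a b : ℕ} (h : a ≤ b) :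
    (X : K⟦X⟧) ^ (a + 1) ∣ eulerProd K b - eulerProd K a := by
  induction b, h using Nat.le_induction with
  | base => simp
  | succ b h ih =>
    have : eulerProd K (b + 1) - eulerProd K a =
        (eulerProd K b - eulerProd K a) - X ^ (b + 1) * eulerProd K b := by
      rw [eulerProd_succ]; ring
    rw [this]
    exact dvd_sub ih ((pow_dvd_pow _ (by omega)).mul_right _)

lemma X_pow_dvd_eulerProd_mul_inv_sub_one {a b : ℕ} (h : a ≤ b) :
    (X : K⟦X⟧) ^ (a + 1) ∣ eulerProd K b * (eulerProd K a)⁻¹ - 1 := by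
  rw [← eulerProd_mul_inv K a, ← sub_mul]
  exact (X_pow_dvd_eulerProd_sub K h).mul_right _

/-- The truncation `∑_{j ≤ n} (-1) ^ j (2 j + 1) X ^ (j (j + 1) / 2)` of the Jacobi series. -/
noncomputable def jacobiCubeSum (n : ℕ) : K⟦X⟧ :=
  ∑ j ∈ range (n + 1), (2 * j + 1 : K⟦X⟧) * ((-1) ^ j * X ^ triangular j)

/-- The Jacobi identity for the cube of the Euler product, modulo `X ^ (n + 1)`. -/
theorem X_pow_dvd_eulerProd_cube_sub (n : ℕ) :
    (X : K⟦X⟧) ^ (n + 1) ∣ eulerProd K n ^ 3 - jacobiCubeSum K n := by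
  rw [pow_succ (eulerProd K n), eulerProd_sq, sum_mul, jacobiCubeSum, ← sum_sub_distrib]
  refine dvd_sum fun j hj ↦ ?_
  have hj : j ≤ n := by simpa [Nat.lt_succ_iff] using hj
  set u := eulerProd K (2 * n + 1) * (eulerProd K (n + 1 + j))⁻¹
  set v := eulerProd K n * (eulerProd K (n - j))⁻¹
  have hu : (X : K⟦X⟧) ^ (n + 1) ∣ u - 1 := (pow_dvd_pow _ (by omega)).trans
    (X_pow_dvd_eulerProd_mul_inv_sub_one K (show n + 1 + j ≤ 2 * n + 1 by omega))
  have hv : (X : K⟦X⟧) ^ (n + 1) ∣ X ^ triangular j * (v - 1) := by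
    refine (pow_dvd_pow _ ?_).trans ((pow_add X (triangular j) (n - j + 1)).dvd.trans
      (mul_dvd_mul_left _ (X_pow_dvd_eulerProd_mul_inv_sub_one K (Nat.sub_le n j))))
    have := le_triangular j
    omega
  have : (2 * j + 1 : K⟦X⟧) * jacobiTerm K n j * eulerProd K n -
      (2 * j + 1 : K⟦X⟧) * ((-1) ^ j * X ^ triangular j) =
      (2 * j + 1 : K⟦X⟧) * (-1) ^ j *
        (X ^ triangular j * v * (u - 1) + X ^ triangular j * (v - 1)) := by
    rw [jacobiTerm, if_pos hj]
    simp only [u, v]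
    ring
  rw [this]
  exact (dvd_add (hu.mul_left _) hv).mul_left _

end FiniteJacobi

/-- The generating function of the partition numbers, with coefficients in `K`. -/
noncomputable def partitionSeries (K : Type*) [Field K] : K⟦X⟧ :=
  PowerSeries.mk fun n ↦ (Fintype.card (Nat.Partition n) : K)

open scoped PowerSeries.WithPiTopology in
theorem pentagonalSeries_mul_partitionSeries (K : Type*) [Field K] :
    pentagonalSeries K * partitionSeries K = 1 := by
  let _ : TopologicalSpace K := ⊥
  have _ : DiscreteTopology K := ⟨rfl⟩
  have h := Nat.Partition.hasProd_powerSeriesMk_card_restricted K (fun _ ↦ True)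
  have h' := (WithPiTopology.hasProd_one_sub_X_pow K).mul h
  have e : (PowerSeries.mk fun n ↦ (#(Nat.Partition.restricted n (fun _ ↦ True)) : K)) =
      partitionSeries K := by
    ext n
    simp [partitionSeries, Nat.Partition.restricted]
  rw [e] at h'
  refine h'.unique ?_
  convert hasProd_one with i
  rw [if_pos trivial, mul_comm]
  simp_rw [pow_mul]
  exact WithPiTopology.tsum_pow_mul_one_sub_of_constantCoeff_eq_zero (by simp)

theorem X_pow_dvd_pentagonalSeries_sub (K : Type*) [Field K] (n : ℕ) :
    (X : K⟦X⟧) ^ (n + 1) ∣ pentagonalSeries K - eulerProd K n := by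
  rw [X_pow_dvd_iff]
  intro d hd
  obtain ⟨s, hs⟩ := Filter.eventually_atTop.mp (coeff_prod_one_sub_X_pow_eventually_eq K d)
  obtain ⟨b, hb⟩ := s.exists_nat_subset_range
  have h1 := hs (range (max b n)) (hb.trans (range_mono (le_max_left _ _)))
  have h2 := X_pow_dvd_iff.mp (X_pow_dvd_eulerProd_sub K (le_max_right b n)) d hd
  rw [map_sub, ← h1]
  rwa [map_sub] at h2

theorem X_pow_dvd_eulerProd_mul_partitionSeries_sub_one (K : Type*) [Field K] (n : ℕ) :
    (X : K⟦X⟧) ^ (n + 1) ∣ eulerProd K n * partitionSeries K - 1 := by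
  rw [← pentagonalSeries_mul_partitionSeries K, ← sub_mul]
  exact ((dvd_sub_comm).mp (X_pow_dvd_pentagonalSeries_sub K n)).mul_right _

/-- In characteristic `p`, a `p`-th power only involves exponents divisible by `p`. -/
theorem coeff_pow_char_eq_zero {K : Type*} [Field K] (p : ℕ) [CharP K p] (f : K⟦X⟧) {d : ℕ}
    (hd : ¬ p ∣ d) : coeff d (f ^ p) = 0 := by
  obtain _ | d := d
  · simp at hd
  have h : derivative K (f ^ p) = 0 := by
    have : (p : K⟦X⟧) = 0 := by rw [← map_natCast (C (R := K)), CharP.cast_eq_zero, map_zero]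
    rw [Derivation.leibniz_pow]
    simp [nsmul_eq_mul, this]
  have h' := congrArg (coeff d) h
  rw [coeff_derivative, map_zero, mul_eq_zero] at h'
  refine h'.resolve_right fun h0 ↦ hd ?_
  rw [← CharP.cast_eq_zero_iff K p]
  exact_mod_cast h0

lemma two_mul_add_one_mul_eq_zero : ∀ x y : ZMod 7,
    x * (x + 1) + y * (y + 1) = 3 → (2 * x + 1) * (2 * y + 1) = 0 := by
  decide

theorem coeff_jacobiCubeSum_sq_eq_zero [Fact (Nat.Prime 7)] (n : ℕ) {a : ℕ} (ha : a % 7 = 5) :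
    coeff a (jacobiCubeSum (ZMod 7) n ^ 2) = 0 := by
  rw [sq, jacobiCubeSum, sum_mul_sum, map_sum]
  refine sum_eq_zero fun i _ ↦ ?_
  rw [map_sum]
  refine sum_eq_zero fun j _ ↦ ?_
  have e : (2 * i + 1 : (ZMod 7)⟦X⟧) * ((-1) ^ i * X ^ triangular i) *
      ((2 * j + 1 : (ZMod 7)⟦X⟧) * ((-1) ^ j * X ^ triangular j)) =
      C ((-1) ^ (i + j) * ((2 * i + 1) * (2 * j + 1)) : ZMod 7) *
        X ^ (triangular i + triangular j) := by
    simp only [map_mul, map_add, map_pow, map_neg, map_one, map_natCast, map_ofNat]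
    ring
  rw [e, coeff_C_mul_X_pow]
  split_ifs with h
  · have hi : (2 * triangular i : ZMod 7) = i * (i + 1) := by
      exact_mod_cast congrArg (Nat.cast (R := ZMod 7)) (two_mul_triangular i)
    have hj : (2 * triangular j : ZMod 7) = j * (j + 1) := by
      exact_mod_cast congrArg (Nat.cast (R := ZMod 7)) (two_mul_triangular j)
    have ha' : (triangular i + triangular j : ZMod 7) = 5 := by
      rw [← Nat.cast_add, ← h, ← ZMod.natCast_mod, ha]; rfl
    have hsq : (i * (i + 1) + j * (j + 1) : ZMod 7) = 3 := by
      rw [← hi, ← hj, ← mul_add, ha']; rfl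
    rw [two_mul_add_one_mul_eq_zero _ _ hsq, mul_zero]
  · rfl

/-- Ramanujan's congruence: `p(7n + 5) ≡ 0 (mod 7)`. -/
theorem partition_seven_n_add_five (n : ℕ) :
    7 ∣ Fintype.card (Nat.Partition (7 * n + 5)) := by
  have : Fact (Nat.Prime 7) := ⟨by norm_num⟩
  rw [← ZMod.natCast_eq_zero_iff]
  set N := 7 * n + 5 with hN
  set P := partitionSeries (ZMod 7)
  set E := eulerProd (ZMod 7) N
  set S := jacobiCubeSum (ZMod 7) N
  have hP : (Fintype.card (Nat.Partition N) : ZMod 7) = coeff N P := by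
    simp [P, partitionSeries]
  have hE : X ^ (N + 1) ∣ E * P - 1 := X_pow_dvd_eulerProd_mul_partitionSeries_sub_one _ N
  have hS : X ^ (N + 1) ∣ E ^ 3 - S := X_pow_dvd_eulerProd_cube_sub _ N
  have hPS : X ^ (N + 1) ∣ P - S ^ 2 * P ^ 7 := by
    have e : P - S ^ 2 * P ^ 7 = (E ^ 3 - S) * ((E ^ 3 + S) * P ^ 7) -
        P * ((E * P) ^ 6 - 1 ^ 6) := by ring
    rw [e]
    exact dvd_sub (hS.mul_right _) ((hE.trans (sub_dvd_pow_sub_pow _ _ _)).mul_left _)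
  have hc := X_pow_dvd_iff.mp hPS N (Nat.lt_succ_self N)
  rw [map_sub, sub_eq_zero] at hc
  rw [hP, hc, coeff_mul]
  refine sum_eq_zero fun ⟨a, b⟩ hab ↦ ?_
  rw [HasAntidiagonal.mem_antidiagonal] at hab
  by_cases hb : 7 ∣ b
  · rw [coeff_jacobiCubeSum_sq_eq_zero N (by dsimp only at *; omega), zero_mul]
  · rw [coeff_pow_char_eq_zero 7 P hb, mul_zero]
end
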